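/- Let X₁, X₂ ⊆ ℤ^n be pseudo-linear sets with X₁ ∩ X₂ = ∅, and let L₁, L₂ be linearizations of X₁, X₂ respectively. Then dim(L₁ ∩ L₂) < dim(X₁ ∪ X₂). -/

import Mathlib

open scoped Pointwise

/-- The finite set `B` generates the set `V` as a ℚ-vector space. -/
def GeneratesQ {n : ℕ} (B : Finset (Fin n → ℚ)) (V : Set (Fin n → ℚ)) : Prop :=
  (Submodule.span ℚ (B : Set (Fin n → ℚ)) : Set (Fin n → ℚ)) = V

/-- The rank of a vector space `V ⊆ ℚ^n`: minimal cardinality of a finite generating set. -/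
noncomputable def rankOf {n : ℕ} (V : Set (Fin n → ℚ)) : ℕ :=
  sInf {d | ∃ B : Finset (Fin n → ℚ), B.card = d ∧ GeneratesQ B V}

-- Dimension of a subset of ℚ^n via finite covers by translates of vector spaces.
open Classical in
noncomputable def dimQ {n : ℕ} (X : Set (Fin n → ℚ)) : WithBot ℕ :=
  if X = ∅ then ⊥ else
    ↑(sInf {d : ℕ | ∃ (k : ℕ) (V : Fin k → Submodule ℚ (Fin n → ℚ))
        (a : Fin k → (Fin n → ℚ)),
        (∀ j, rankOf ((V j : Set (Fin n → ℚ))) ≤ d) ∧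
        X ⊆ ⋃ j, (a j +ᵥ (V j : Set (Fin n → ℚ)))})

/-- Dimension of a subset of ℤ^n, via the canonical embedding ℤ^n → ℚ^n. -/
noncomputable def dimZ {n : ℕ} (X : Set (Fin n → ℤ)) : WithBot ℕ :=
  dimQ ((fun (x : Fin n → ℤ) (i : Fin n) => (x i : ℚ)) '' X)

/-- `a` is an interior vector of the monoid `M ⊆ ℤ^n`. -/
def IsInteriorZ {n : ℕ} (M : Set (Fin n → ℤ)) (a : Fin n → ℤ) : Prop :=
  a ∈ M ∧ ∀ x ∈ M, ∃ N : ℕ, 1 ≤ N ∧ ∃ m ∈ M, N • a = x + m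

/-- `M` is a finitely generated (additive sub)monoid of ℤ^n (as a set). -/
def IsFGMonoid {n : ℕ} (M : Set (Fin n → ℤ)) : Prop :=
  ∃ P : Finset (Fin n → ℤ),
    M = (AddSubmonoid.closure (P : Set (Fin n → ℤ)) : Set (Fin n → ℤ))

/-- `L` is a linearization of the pseudo-linear set `X`. -/
def IsLinearization {n : ℕ} (L X : Set (Fin n → ℤ)) : Prop :=
  ∃ (b : Fin n → ℤ) (M : Set (Fin n → ℤ)), IsFGMonoid M ∧ L = b +ᵥ M ∧ X ⊆ L ∧
    ∀ R : Finset (Fin n → ℤ), (∀ r ∈ R, IsInteriorZ M r) →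
      ∃ x ∈ X, x +ᵥ (AddSubmonoid.closure (R : Set (Fin n → ℤ)) : Set (Fin n → ℤ)) ⊆ X

/-- `X ⊆ ℤ^n` is pseudo-linear. -/
def IsPseudoLinear {n : ℕ} (X : Set (Fin n → ℤ)) : Prop :=
  ∃ L, IsLinearization L X

/-- The canonical embedding `ℤ^n → ℚ^n`. -/
def castVec (n : ℕ) : (Fin n → ℤ) →+ (Fin n → ℚ) :=
  (Int.castAddHom ℚ).compLeft (Fin n)

theorem castVec_injective (n : ℕ) : Function.Injective (castVec n) := fun x y h => by
  funext i
  have := congrFun h i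
  simpa [castVec] using this

/-- The `ℚ`-vector space spanned by a set of integer vectors. -/
def spanQ {n : ℕ} (M : Set (Fin n → ℤ)) : Submodule ℚ (Fin n → ℚ) :=
  Submodule.span ℚ (castVec n '' M)

theorem castVec_mem_spanQ {n : ℕ} {M : Set (Fin n → ℤ)} {x : Fin n → ℤ} (hx : x ∈ M) :
    castVec n x ∈ spanQ M :=
  Submodule.subset_span ⟨x, hx, rfl⟩

theorem spanQ_mono {n : ℕ} {M N : Set (Fin n → ℤ)} (h : M ⊆ N) : spanQ M ≤ spanQ N :=
  Submodule.span_mono (Set.image_mono h)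

theorem rankOf_eq_finrank {n : ℕ} (W : Submodule ℚ (Fin n → ℚ)) :
    rankOf (W : Set (Fin n → ℚ)) = Module.finrank ℚ W := by
  obtain ⟨t, -, hcard, hspan, -⟩ := Submodule.exists_finset_span_eq_linearIndepOn ℚ
    (W : Set (Fin n → ℚ))
  rw [Submodule.span_eq] at hcard hspan
  have hmem : Module.finrank ℚ W ∈
      {d | ∃ B : Finset (Fin n → ℚ), B.card = d ∧ GeneratesQ B (W : Set (Fin n → ℚ))} :=
    ⟨t, hcard, congrArg _ hspan⟩
  refine le_antisymm (Nat.sInf_le hmem) (le_csInf ⟨_, hmem⟩ ?_)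
  rintro d ⟨B, rfl, hB⟩
  rw [← SetLike.coe_injective hB]
  exact finrank_span_finset_le_card B

theorem dimQ_le {n : ℕ} {X : Set (Fin n → ℚ)} {d k : ℕ} (V : Fin k → Submodule ℚ (Fin n → ℚ))
    (a : Fin k → (Fin n → ℚ)) (hV : ∀ j, Module.finrank ℚ (V j) ≤ d)
    (hX : X ⊆ ⋃ j, (a j +ᵥ (V j : Set (Fin n → ℚ)))) : dimQ X ≤ d := by
  unfold dimQ
  split_ifs
  · exact bot_le
  · exact WithBot.coe_le_coe.2
      (Nat.sInf_le ⟨k, V, a, fun j => (rankOf_eq_finrank _).trans_le (hV j), hX⟩)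

theorem le_dimQ {n : ℕ} {X : Set (Fin n → ℚ)} {d : ℕ} (hne : X.Nonempty)
    (h : ∀ (k : ℕ) (V : Fin k → Submodule ℚ (Fin n → ℚ)) (a : Fin k → (Fin n → ℚ)),
      X ⊆ ⋃ j, (a j +ᵥ (V j : Set (Fin n → ℚ))) → ∃ j, d ≤ Module.finrank ℚ (V j)) :
    (d : WithBot ℕ) ≤ dimQ X := by
  unfold dimQ
  rw [if_neg hne.ne_empty]
  refine WithBot.coe_le_coe.2 (le_csInf ?_ ?_)
  · exact ⟨_, 1, fun _ => ⊤, fun _ => 0, fun _ => le_rfl, fun x _ =>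
      Set.mem_iUnion.2 ⟨0, by simp⟩⟩
  · rintro e ⟨k, V, a, hr, hX⟩
    obtain ⟨j, hj⟩ := h k V a hX
    exact hj.trans ((rankOf_eq_finrank _).symm.trans_le (hr j))

theorem exists_mem_forall_notMem {E ι : Type*} [AddCommGroup E] [Module ℚ E]
    (S : AddSubmonoid E) (W : ι → Submodule ℚ E) (J : Finset ι)
    (h : ∀ j ∈ J, ∃ z ∈ S, z ∉ W j) : ∃ y ∈ S, ∀ j ∈ J, y ∉ W j := by
  classical
  induction J using Finset.induction_on with
  | empty => exact ⟨0, S.zero_mem, by simp⟩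
  | insert i J hi ih =>
    obtain ⟨y, hy, hyJ⟩ := ih fun j hj => h j (Finset.mem_insert_of_mem hj)
    obtain ⟨z, hz, hzi⟩ := h i (Finset.mem_insert_self i J)
    have hsub : ∀ j ∈ insert i J, {N : ℕ | z + N • y ∈ W j}.Subsingleton := by
      intro j hj N hN N' hN'
      by_contra hne
      have hyj : y ∈ W j := by
        have hd : ((N : ℚ) - N') • y ∈ W j := by
          have := (W j).sub_mem hN hN'
          simpa [sub_smul, Nat.cast_smul_eq_nsmul] using this
        exact ((W j).smul_mem_iff (sub_ne_zero.2 (Nat.cast_injective.ne hne))).1 hd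
      rcases Finset.mem_insert.1 hj with rfl | hj
      · exact hzi (((W j).add_mem_iff_left ((W j).toAddSubmonoid.nsmul_mem hyj N)).1 hN)
      · exact hyJ j hj hyj
    have hfin : (⋃ j ∈ insert i J, {N : ℕ | z + N • y ∈ W j}).Finite :=
      (insert i J).finite_toSet.biUnion fun j hj => (hsub j hj).finite
    obtain ⟨N, hN⟩ := hfin.exists_notMem
    refine ⟨z + N • y, S.add_mem hz (S.nsmul_mem hy N), fun j hj hmem => hN ?_⟩
    exact Set.mem_biUnion (x := j) hj hmem

theorem exists_le_of_subset_iUnion_vadd {E : Type*} [AddCommGroup E] [Module ℚ E]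
    (S : AddSubmonoid E) (x : E) {k : ℕ} (W : Fin k → Submodule ℚ E) (a : Fin k → E)
    (h : x +ᵥ (S : Set E) ⊆ ⋃ j, (a j +ᵥ (W j : Set E))) :
    ∃ j, (S : Set E) ⊆ W j := by
  by_contra! hcon
  obtain ⟨y, hy, hyW⟩ := exists_mem_forall_notMem S W Finset.univ
    fun j _ => Set.not_subset.1 (hcon j)
  have hcov : ∀ N : ℕ, ∃ j, -a j + (x + N • y) ∈ W j := fun N => by
    obtain ⟨j, hj⟩ := Set.mem_iUnion.1
      (h (Set.vadd_mem_vadd_set (a := x) (S.nsmul_mem hy N)))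
    exact ⟨j, by simpa [Set.mem_vadd_set_iff_neg_vadd_mem] using hj⟩
  choose f hf using hcov
  obtain ⟨N, N', hne, heq⟩ := Finite.exists_ne_map_eq_of_infinite f
  refine hyW (f N) (Finset.mem_univ _) ?_
  have hd : ((N : ℚ) - N') • y ∈ W (f N) := by
    have := (W (f N)).sub_mem (hf N) (heq ▸ hf N')
    simpa [sub_smul, Nat.cast_smul_eq_nsmul] using this
  exact ((W (f N)).smul_mem_iff (sub_ne_zero.2 (Nat.cast_injective.ne hne))).1 hd

theorem exists_nsmul_eq_sub_of_mem_spanQ {n : ℕ} (N : AddSubmonoid (Fin n → ℤ))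
    {v : Fin n → ℚ} (hv : v ∈ spanQ (N : Set (Fin n → ℤ))) :
    ∃ k : ℕ, 1 ≤ k ∧ ∃ u ∈ N, ∃ w ∈ N, k • v = castVec n u - castVec n w := by
  induction hv using Submodule.span_induction with
  | mem x hx =>
    obtain ⟨u, hu, rfl⟩ := hx
    exact ⟨1, le_rfl, u, hu, 0, N.zero_mem, by simp⟩
  | zero => exact ⟨1, le_rfl, 0, N.zero_mem, 0, N.zero_mem, by simp⟩
  | add x y _ _ hx hy =>
    obtain ⟨k, hk, u, hu, w, hw, h⟩ := hx
    obtain ⟨k', hk', u', hu', w', hw', h'⟩ := hy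
    refine ⟨k * k', Nat.mul_pos hk hk', k' • u + k • u',
      N.add_mem (N.nsmul_mem hu _) (N.nsmul_mem hu' _), k' • w + k • w',
      N.add_mem (N.nsmul_mem hw _) (N.nsmul_mem hw' _), ?_⟩
    have e : (k * k') • (x + y) = k' • (k • x) + k • (k' • y) := by module
    rw [e, h, h']
    simp only [map_add, map_nsmul]
    module
  | smul q x _ hx =>
    obtain ⟨k, hk, u, hu, w, hw, h⟩ := hx
    have e : (q.den * k) • (q • x) = q.num • (k • x) := by
      have hq : (q.den : ℚ) * q = q.num := by rw [mul_comm, Rat.mul_den_eq_num]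
      rw [← Nat.cast_smul_eq_nsmul ℚ, ← Nat.cast_smul_eq_nsmul ℚ k, ← Int.cast_smul_eq_zsmul ℚ,
        smul_smul, smul_smul, ← hq]
      push_cast
      congr 1
      ring
    rcases Int.eq_nat_or_neg q.num with ⟨p, hp | hp⟩
    · refine ⟨q.den * k, Nat.mul_pos q.pos hk, p • u, N.nsmul_mem hu _, p • w,
        N.nsmul_mem hw _, ?_⟩
      rw [e, h, hp]
      simp only [smul_sub, natCast_zsmul, map_nsmul]
    · refine ⟨q.den * k, Nat.mul_pos q.pos hk, p • w, N.nsmul_mem hw _, p • u,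
        N.nsmul_mem hu _, ?_⟩
      rw [e, h, hp]
      simp only [neg_smul, natCast_zsmul, map_nsmul, smul_sub, neg_sub_neg]

theorem IsInteriorZ.add_mem {n : ℕ} {M : AddSubmonoid (Fin n → ℤ)} {a m : Fin n → ℤ}
    (ha : IsInteriorZ (M : Set (Fin n → ℤ)) a) (hm : m ∈ M) :
    IsInteriorZ (M : Set (Fin n → ℤ)) (a + m) := by
  refine ⟨M.add_mem ha.1 hm, fun x hx => ?_⟩
  obtain ⟨N, hN, y, hy, h⟩ := ha.2 x hx
  exact ⟨N, hN, y + N • m, M.add_mem hy (M.nsmul_mem hm N), by rw [smul_add, h, add_assoc]⟩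

theorem exists_isInteriorZ {n : ℕ} (P : Finset (Fin n → ℤ)) (N : AddSubmonoid (Fin n → ℤ))
    (hN : N ≤ AddSubmonoid.closure (P : Set (Fin n → ℤ)))
    (hspan : spanQ (AddSubmonoid.closure (P : Set (Fin n → ℤ)) : Set (Fin n → ℤ)) ≤ spanQ N) :
    ∃ a ∈ N, IsInteriorZ (AddSubmonoid.closure (P : Set (Fin n → ℤ)) : Set (Fin n → ℤ)) a := by
  set M := AddSubmonoid.closure (P : Set (Fin n → ℤ)) with hM
  have hgen : ∀ p : P, ∃ a ∈ N, ∃ m ∈ M, a = p + m := fun p => by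
    have hp : (p : Fin n → ℤ) ∈ M := AddSubmonoid.subset_closure p.2
    obtain ⟨k, hk, u, hu, w, hw, h⟩ := exists_nsmul_eq_sub_of_mem_spanQ N
      (hspan (castVec_mem_spanQ hp))
    obtain ⟨k, rfl⟩ := Nat.exists_eq_add_of_le hk
    refine ⟨u, hu, k • p + w, M.add_mem (M.nsmul_mem hp k) (hN hw), castVec_injective n ?_⟩
    rw [eq_sub_iff_add_eq] at h
    rw [← h]
    simp only [map_add, map_nsmul]
    module
  choose a haN m hm ham using hgen
  have hsum : ∑ p, a p ∈ N := sum_mem fun p _ => haN p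
  refine ⟨∑ p, a p, hsum, hN hsum, fun x hx => ?_⟩
  suffices ∃ K : ℕ, ∃ y ∈ M, K • ∑ p, a p = x + y by
    obtain ⟨K, y, hy, h⟩ := this
    exact ⟨K + 1, Nat.le_add_left 1 K, y + ∑ p, a p, M.add_mem hy (hN hsum), by
      rw [succ_nsmul, h, add_assoc]⟩
  induction hx using AddSubmonoid.closure_induction with
  | mem p hp =>
    refine ⟨1, m ⟨p, hp⟩ + ∑ q ∈ Finset.univ.erase ⟨p, hp⟩, a q,
      M.add_mem (hm _) (sum_mem fun q _ => hN (haN q)), ?_⟩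
    rw [one_nsmul, ← Finset.add_sum_erase _ _ (Finset.mem_univ (⟨p, hp⟩ : P)),
      ham ⟨p, hp⟩, add_assoc]
  | zero => exact ⟨0, 0, M.zero_mem, by simp⟩
  | add x y _ _ hx hy =>
    obtain ⟨K, u, hu, h⟩ := hx
    obtain ⟨K', u', hu', h'⟩ := hy
    exact ⟨K + K', u + u', M.add_mem hu hu', by rw [add_nsmul, h, h', add_add_add_comm]⟩

/-- The interior vectors `a` and `a + p`, for `p` ranging over the generators `P`. -/
def shiftedGens {n : ℕ} (P : Finset (Fin n → ℤ)) (a : Fin n → ℤ) : Finset (Fin n → ℤ) :=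
  insert a (P.image (a + ·))

theorem isInteriorZ_of_mem_shiftedGens {n : ℕ} {P : Finset (Fin n → ℤ)} {a r : Fin n → ℤ}
    (ha : IsInteriorZ (AddSubmonoid.closure (P : Set (Fin n → ℤ)) : Set (Fin n → ℤ)) a)
    (hr : r ∈ shiftedGens P a) :
    IsInteriorZ (AddSubmonoid.closure (P : Set (Fin n → ℤ)) : Set (Fin n → ℤ)) r := by
  rcases Finset.mem_insert.1 hr with rfl | hr
  · exact ha
  · obtain ⟨p, hp, rfl⟩ := Finset.mem_image.1 hr
    exact ha.add_mem (AddSubmonoid.subset_closure hp)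

theorem mem_closure_shiftedGens {n : ℕ} (P : Finset (Fin n → ℤ)) (a : Fin n → ℤ) :
    a ∈ AddSubmonoid.closure (shiftedGens P a : Set (Fin n → ℤ)) :=
  AddSubmonoid.subset_closure (Finset.mem_insert_self _ _)

theorem exists_add_nsmul_mem_closure_shiftedGens {n : ℕ} {P : Finset (Fin n → ℤ)}
    (a : Fin n → ℤ) {m : Fin n → ℤ} (hm : m ∈ AddSubmonoid.closure (P : Set (Fin n → ℤ))) :
    ∃ K : ℕ, m + K • a ∈ AddSubmonoid.closure (shiftedGens P a : Set (Fin n → ℤ)) := by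
  induction hm using AddSubmonoid.closure_induction with
  | mem p hp =>
    refine ⟨1, AddSubmonoid.subset_closure ?_⟩
    rw [one_nsmul, add_comm]
    exact Finset.mem_insert_of_mem (Finset.mem_image_of_mem _ hp)
  | zero => exact ⟨0, by simp⟩
  | add x y _ _ hx hy =>
    obtain ⟨K, hK⟩ := hx
    obtain ⟨K', hK'⟩ := hy
    refine ⟨K + K', ?_⟩
    rw [add_nsmul, add_add_add_comm]
    exact AddSubmonoid.add_mem _ hK hK'

theorem eventually_add_nsmul_mem {n : ℕ} {X : Set (Fin n → ℤ)} {b a c : Fin n → ℤ}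
    {P : Finset (Fin n → ℤ)}
    (ha : IsInteriorZ (AddSubmonoid.closure (P : Set (Fin n → ℤ)) : Set (Fin n → ℤ)) a)
    (hX : X ⊆ b +ᵥ (AddSubmonoid.closure (P : Set (Fin n → ℤ)) : Set (Fin n → ℤ)))
    (hR : ∃ x ∈ X, x +ᵥ
      (AddSubmonoid.closure (shiftedGens P a : Set (Fin n → ℤ)) : Set (Fin n → ℤ)) ⊆ X)
    (hc : c ∈ b +ᵥ (AddSubmonoid.closure (P : Set (Fin n → ℤ)) : Set (Fin n → ℤ))) :
    ∀ᶠ K : ℕ in Filter.atTop, c + K • a ∈ X := by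
  obtain ⟨x, hx, hxX⟩ := hR
  obtain ⟨m, hm, rfl⟩ := hc
  obtain ⟨l, hl, rfl⟩ := hX hx
  obtain ⟨N, -, l', hl', hN⟩ := ha.2 l hl
  obtain ⟨K₁, hK₁⟩ := exists_add_nsmul_mem_closure_shiftedGens a hm
  obtain ⟨K₂, hK₂⟩ := exists_add_nsmul_mem_closure_shiftedGens a hl'
  filter_upwards [Filter.eventually_ge_atTop (K₁ + K₂ + N)] with K hK
  obtain ⟨K, rfl⟩ := Nat.exists_eq_add_of_le hK
  have hmem := hxX (Set.vadd_mem_vadd_set (a := b +ᵥ l) (AddSubmonoid.add_mem _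
    (AddSubmonoid.add_mem _ hK₁ hK₂)
    (AddSubmonoid.nsmul_mem _ (mem_closure_shiftedGens P a) K)))
  convert hmem using 1
  simp only [vadd_eq_add, add_nsmul, hN]
  abel

theorem finrank_spanQ_le_dimZ {n : ℕ} {X Y : Set (Fin n → ℤ)} {P : Finset (Fin n → ℤ)}
    (hXY : X ⊆ Y)
    (hX : ∀ R : Finset (Fin n → ℤ), (∀ r ∈ R,
      IsInteriorZ (AddSubmonoid.closure (P : Set (Fin n → ℤ)) : Set (Fin n → ℤ)) r) →
      ∃ x ∈ X, x +ᵥ (AddSubmonoid.closure (R : Set (Fin n → ℤ)) : Set (Fin n → ℤ)) ⊆ X) :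
    (Module.finrank ℚ
      (spanQ (AddSubmonoid.closure (P : Set (Fin n → ℤ)) : Set (Fin n → ℤ))) : WithBot ℕ) ≤
      dimZ Y := by
  obtain ⟨a, -, ha⟩ := exists_isInteriorZ P _ le_rfl le_rfl
  obtain ⟨x, hx, hxX⟩ := hX _ fun r hr => isInteriorZ_of_mem_shiftedGens ha hr
  refine le_dimQ ⟨_, x, hXY hx, rfl⟩ fun k V v hcov => ?_
  set S := AddSubmonoid.closure (shiftedGens P a : Set (Fin n → ℤ))
  obtain ⟨j, hj⟩ := exists_le_of_subset_iUnion_vadd (S.map (castVec n)) (castVec n x) V v (by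
    refine subset_trans ?_ hcov
    rintro _ ⟨_, ⟨s, hs, rfl⟩, rfl⟩
    exact ⟨x + s, hXY <| hxX (Set.vadd_mem_vadd_set (a := x) hs), map_add (castVec n) x s⟩)
  refine ⟨j, Submodule.finrank_mono (Submodule.span_le.2 ?_)⟩
  rintro _ ⟨m, hm, rfl⟩
  obtain ⟨K, hK⟩ := exists_add_nsmul_mem_closure_shiftedGens a hm
  have h₁ : castVec n (m + K • a) ∈ V j := hj ⟨_, hK, rfl⟩
  have h₂ : castVec n (K • a) ∈ V j :=
    hj ⟨_, S.nsmul_mem (mem_closure_shiftedGens P a) K, rfl⟩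
  rw [map_add] at h₁
  exact ((V j).add_mem_iff_left h₂).1 h₁

theorem exists_coeff_order {E : Type*} [AddCommGroup E] (b : E) (P : Finset E) :
    ∃ f : E → P → ℕ, ∀ x ∈ b +ᵥ (AddSubmonoid.closure (P : Set E) : Set E),
      ∀ y ∈ b +ᵥ (AddSubmonoid.closure (P : Set E) : Set E),
        f x ≤ f y → y - x ∈ AddSubmonoid.closure (P : Set E) := by
  classical
  have h : ∀ x, ∃ f : P → ℕ, x ∈ b +ᵥ (AddSubmonoid.closure (P : Set E) : Set E) →
      x = b + ∑ p, f p • (p : E) := fun x => by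
    by_cases hx : x ∈ b +ᵥ (AddSubmonoid.closure (P : Set E) : Set E)
    · obtain ⟨m, hm, rfl⟩ := hx
      obtain ⟨f, hf⟩ := AddSubmonoid.mem_closure_finset'.1 hm
      exact ⟨f, fun _ => by rw [← hf]; rfl⟩
    · exact ⟨0, fun h => absurd h hx⟩
  choose f hf using h
  refine ⟨f, fun x hx y hy hxy => ?_⟩
  have e : y - x = ∑ p, (f y p - f x p) • (p : E) := by
    rw [hf y hy, hf x hx, add_sub_add_left_eq_sub, ← hf x hx, ← hf y hy,
      ← Finset.sum_sub_distrib]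
    exact Finset.sum_congr rfl fun p _ => by rw [sub_eq_iff_eq_add, ← add_nsmul,
      Nat.sub_add_cancel (hxy p)]
  rw [e]
  exact sum_mem fun p _ => AddSubmonoid.nsmul_mem _ (AddSubmonoid.subset_closure p.2) _

/-- An intersection of two translates of finitely generated monoids is covered by finitely many
translates of the intersection of the monoids. -/
theorem exists_finite_cover_inter {E : Type*} [AddCommGroup E] (b₁ b₂ : E) (P₁ P₂ : Finset E) :
    ∃ C : Set E, C.Finite ∧
      (b₁ +ᵥ (AddSubmonoid.closure (P₁ : Set E) : Set E)) ∩
        (b₂ +ᵥ (AddSubmonoid.closure (P₂ : Set E) : Set E)) ⊆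
      {y | ∃ c ∈ C,
        y - c ∈ AddSubmonoid.closure (P₁ : Set E) ⊓ AddSubmonoid.closure (P₂ : Set E)} := by
  obtain ⟨f₁, hf₁⟩ := exists_coeff_order b₁ P₁
  obtain ⟨f₂, hf₂⟩ := exists_coeff_order b₂ P₂
  set L := (b₁ +ᵥ (AddSubmonoid.closure (P₁ : Set E) : Set E)) ∩
    (b₂ +ᵥ (AddSubmonoid.closure (P₂ : Set E) : Set E))
  let f : E → (P₁ → ℕ) × (P₂ → ℕ) := fun x => (f₁ x, f₂ x)
  have hfin : {z | Minimal (· ∈ f '' L) z}.Finite :=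
    WellQuasiOrderedLE.finite_of_isAntichain (setOfPred_minimal_antichain _)
  have hsub : {z | Minimal (· ∈ f '' L) z} ⊆ f '' L := fun z hz => hz.prop
  obtain ⟨C, hCL, hC, hCf⟩ := (Set.exists_subset_image_finite_and
    (p := (· = {z | Minimal (· ∈ f '' L) z}))).1 ⟨_, hsub, hfin, rfl⟩
  refine ⟨C, hC, fun y hy => ?_⟩
  obtain ⟨z, hzy, hz⟩ := exists_minimal_le_of_wellFoundedLT (· ∈ f '' L) (f y) ⟨y, hy, rfl⟩
  obtain ⟨c, hc, rfl⟩ : z ∈ f '' C := by rw [hCf]; exact hz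
  exact ⟨c, hc, hf₁ c (hCL hc).1 y hy.1 hzy.1, hf₂ c (hCL hc).2 y hy.2 hzy.2⟩

theorem dimZ_inter_le {n : ℕ} (b₁ b₂ : Fin n → ℤ) (P₁ P₂ : Finset (Fin n → ℤ)) :
    dimZ ((b₁ +ᵥ (AddSubmonoid.closure (P₁ : Set (Fin n → ℤ)) : Set (Fin n → ℤ))) ∩
      (b₂ +ᵥ (AddSubmonoid.closure (P₂ : Set (Fin n → ℤ)) : Set (Fin n → ℤ)))) ≤
    (Module.finrank ℚ (spanQ ((AddSubmonoid.closure (P₁ : Set (Fin n → ℤ)) ⊓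
      AddSubmonoid.closure (P₂ : Set (Fin n → ℤ)) : AddSubmonoid (Fin n → ℤ)) :
      Set (Fin n → ℤ))) :
      WithBot ℕ) := by
  obtain ⟨C, hC, hcov⟩ := exists_finite_cover_inter b₁ b₂ P₁ P₂
  obtain ⟨k, c, -, rfl⟩ := hC.fin_param
  refine dimQ_le (fun _ : Fin k => _) (fun j => castVec n (c j)) (fun _ => le_rfl) ?_
  rintro _ ⟨y, hy, rfl⟩
  obtain ⟨_, ⟨j, rfl⟩, hj⟩ := hcov hy
  refine Set.mem_iUnion.2 ⟨j, castVec n (y - c j), castVec_mem_spanQ hj, ?_⟩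
  exact (map_add (castVec n) _ _).symm.trans (congrArg (castVec n) (add_sub_cancel _ _))

theorem stmt12 {n : ℕ} (X₁ X₂ L₁ L₂ : Set (Fin n → ℤ))
    (h₁ : IsLinearization L₁ X₁) (h₂ : IsLinearization L₂ X₂)
    (hdisj : X₁ ∩ X₂ = ∅) :
    dimZ (L₁ ∩ L₂) < dimZ (X₁ ∪ X₂) := by
  obtain ⟨b₁, _, ⟨P₁, rfl⟩, rfl, hX₁, hR₁⟩ := h₁
  obtain ⟨b₂, _, ⟨P₂, rfl⟩, rfl, hX₂, hR₂⟩ := h₂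
  have hle₁ := finrank_spanQ_le_dimZ (Y := X₁ ∪ X₂) Set.subset_union_left hR₁
  have hle₂ := finrank_spanQ_le_dimZ (Y := X₁ ∪ X₂) Set.subset_union_right hR₂
  have hinter := dimZ_inter_le b₁ b₂ P₁ P₂
  set M₁ := AddSubmonoid.closure (P₁ : Set (Fin n → ℤ))
  set M₂ := AddSubmonoid.closure (P₂ : Set (Fin n → ℤ))
  have hN₁ : spanQ ((M₁ ⊓ M₂ : AddSubmonoid (Fin n → ℤ)) : Set (Fin n → ℤ)) ≤
    spanQ (M₁ : Set (Fin n → ℤ)) := spanQ_mono Set.inter_subset_left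
  have hN₂ : spanQ ((M₁ ⊓ M₂ : AddSubmonoid (Fin n → ℤ)) : Set (Fin n → ℤ)) ≤
    spanQ (M₂ : Set (Fin n → ℤ)) := spanQ_mono Set.inter_subset_right
  rcases hN₁.lt_or_eq with hlt | heq₁
  · exact hinter.trans_lt
      ((WithBot.coe_lt_coe.2 (Submodule.finrank_lt_finrank_of_lt hlt)).trans_le hle₁)
  rcases hN₂.lt_or_eq with hlt | heq₂
  · exact hinter.trans_lt
      ((WithBot.coe_lt_coe.2 (Submodule.finrank_lt_finrank_of_lt hlt)).trans_le hle₂)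
  obtain ⟨a₁, ha₁, hint₁⟩ := exists_isInteriorZ P₁ (M₁ ⊓ M₂) inf_le_left heq₁.ge
  obtain ⟨a₂, ha₂, hint₂⟩ := exists_isInteriorZ P₂ (M₁ ⊓ M₂) inf_le_right heq₂.ge
  replace hint₁ := hint₁.add_mem ha₂.1
  replace hint₂ := hint₂.add_mem ha₁.2
  rw [add_comm] at hint₂
  rcases Set.eq_empty_or_nonempty ((b₁ +ᵥ (M₁ : Set (Fin n → ℤ))) ∩
    (b₂ +ᵥ (M₂ : Set (Fin n → ℤ)))) with hempty | ⟨c, hc₁, hc₂⟩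
  · rw [hempty]
    refine lt_of_lt_of_le ?_ hle₁
    simp [dimZ, dimQ]
  · obtain ⟨K, hK₁, hK₂⟩ := ((eventually_add_nsmul_mem hint₁ hX₁
      (hR₁ _ fun r hr => isInteriorZ_of_mem_shiftedGens hint₁ hr) hc₁).and
      (eventually_add_nsmul_mem hint₂ hX₂
        (hR₂ _ fun r hr => isInteriorZ_of_mem_shiftedGens hint₂ hr) hc₂)).exists
    exact absurd (show c + K • (a₁ + a₂) ∈ X₁ ∩ X₂ from ⟨hK₁, hK₂⟩) (by simp [hdisj])
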